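/- arXiv:2003.00078 — 3 statements merged into one kernel-verified Lean document; each statement's English description precedes it below -/
import Mathlib

section
/- Let x₁, …, xₙ ∈ ℝ^q be nonzero vectors that span ℝ^q, let η > 0, and let u : ℝ → ℝ be non-increasing on (0,∞) with u(s) > 0 for all s > 0 and s·u(s) ≤ κ for all s > 0 with 0 ≤ κ < 1. Then there exists a constant c > 0, depending only on x₁, …, xₙ, η, u and the contamination size m, such that for every choice of contamination points y₁, …, y_m ∈ ℝ^q and every positive semidefinite q×q matrix V satisfying the hybrid M-estimating equation V = (1/(n+m)) ∑_{z ∈ Z} u(zᵀ (V + η I_q)⁻¹ z) z zᵀ over the combined sample Z = {x₁,…,xₙ, y₁,…,y_m}, one has c I_q ≤ V ≤ (η κ/(1−κ)) I_q in the Loewner order. Hence the hybrid M-estimator defined by this equation cannot break down under contamination. -/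
open Matrix

namespace Matrix

variable {ι : Type*}

theorem isHermitian_sum_smul_vecMulVec_self {k : Type*} [Fintype k] (w : k → ℝ)
    (z : k → ι → ℝ) : (∑ i, w i • vecMulVec (z i) (z i)).IsHermitian := by
  ext i j
  simp [sum_apply, vecMulVec_apply, mul_comm]

theorem PosSemidef.posDef_add_smul_one [DecidableEq ι] {V : Matrix ι ι ℝ} (hV : V.PosSemidef)
    {η : ℝ} (hη : 0 < η) : (V + η • (1 : Matrix ι ι ℝ)).PosDef :=
  PosDef.posSemidef_add hV (PosDef.one.smul hη)

variable [Fintype ι]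

theorem dotProduct_vecMulVec_self_mulVec (z a : ι → ℝ) :
    a ⬝ᵥ vecMulVec z z *ᵥ a = (z ⬝ᵥ a) ^ 2 := by
  rw [vecMulVec_mulVec, op_smul_eq_smul, dotProduct_smul, smul_eq_mul, dotProduct_comm a z, sq]

theorem dotProduct_sum_smul_vecMulVec_self_mulVec {k : Type*} [Fintype k] (w : k → ℝ)
    (z : k → ι → ℝ) (a : ι → ℝ) :
    a ⬝ᵥ (∑ i, w i • vecMulVec (z i) (z i)) *ᵥ a = ∑ i, w i * (z i ⬝ᵥ a) ^ 2 := by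
  simp only [sum_mulVec, dotProduct_sum, smul_mulVec, dotProduct_smul, smul_eq_mul,
    dotProduct_vecMulVec_self_mulVec]

theorem posDef_sum_smul_vecMulVec_self {k : Type*} [Fintype k] {w : k → ℝ} (hw : ∀ i, 0 < w i)
    {z : k → ι → ℝ} (hz : Submodule.span ℝ (Set.range z) = ⊤) :
    (∑ i, w i • vecMulVec (z i) (z i)).PosDef := by
  refine .of_dotProduct_mulVec_pos (isHermitian_sum_smul_vecMulVec_self w z) fun a ha => ?_
  rw [star_trivial, dotProduct_sum_smul_vecMulVec_self_mulVec]
  have hnn : ∀ i ∈ Finset.univ, 0 ≤ w i * (z i ⬝ᵥ a) ^ 2 := fun i _ =>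
    mul_nonneg (hw i).le (sq_nonneg _)
  refine (Finset.sum_nonneg hnn).lt_of_ne' fun h0 => ha ?_
  rw [Finset.sum_eq_zero_iff_of_nonneg hnn] at h0
  have hort : ∀ v ∈ Submodule.span ℝ (Set.range z), v ⬝ᵥ a = 0 := fun v hv => by
    induction hv using Submodule.span_induction with
    | mem v hv =>
      obtain ⟨i, rfl⟩ := hv
      simpa [(hw i).ne'] using h0 i (Finset.mem_univ i)
    | zero => exact zero_dotProduct a
    | add v v' _ _ h h' => rw [add_dotProduct, h, h', add_zero]
    | smul t v _ h => rw [smul_dotProduct, h, smul_zero]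
  exact dotProduct_self_eq_zero.1 (hort a (hz ▸ Submodule.mem_top))

variable [DecidableEq ι]

/-- Cauchy-Schwarz inequality for the dual pair of norms given by `W` and `W⁻¹`. -/
theorem PosDef.sq_dotProduct_le {W : Matrix ι ι ℝ} (hW : W.PosDef) (z a : ι → ℝ) :
    (z ⬝ᵥ a) ^ 2 ≤ (z ⬝ᵥ W⁻¹ *ᵥ z) * (a ⬝ᵥ W *ᵥ a) := by
  have hWz : W *ᵥ (W⁻¹ *ᵥ z) = z := by
    rw [mulVec_mulVec, mul_nonsing_inv _ (hW.isUnit.map detMonoidHom), one_mulVec]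
  have hsymm : (W⁻¹ *ᵥ z) ⬝ᵥ W *ᵥ a = z ⬝ᵥ a := by
    have hT : Wᵀ = W := hW.isHermitian
    rw [dotProduct_mulVec, ← mulVec_transpose, hT, hWz]
  have h := discrim_le_zero (a := z ⬝ᵥ W⁻¹ *ᵥ z) (b := -2 * (z ⬝ᵥ a)) (c := a ⬝ᵥ W *ᵥ a)
    fun t => by
      have ht := hW.posSemidef.dotProduct_mulVec_nonneg (a - t • W⁻¹ *ᵥ z)
      simp only [star_trivial, mulVec_sub, mulVec_smul, hWz, sub_dotProduct, dotProduct_sub,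
        smul_dotProduct, dotProduct_smul, smul_eq_mul, hsymm] at ht
      rw [dotProduct_comm a z, dotProduct_comm (W⁻¹ *ᵥ z) z] at ht
      linarith
  rw [discrim] at h
  nlinarith

theorem PosDef.exists_pos_mul_dotProduct_self_le [Nonempty ι] {M : Matrix ι ι ℝ}
    (hM : M.PosDef) : ∃ c : ℝ, 0 < c ∧ ∀ a : ι → ℝ, c * (a ⬝ᵥ a) ≤ a ⬝ᵥ M *ᵥ a := by
  have htr : 0 < M⁻¹.trace := hM.inv.trace_pos
  refine ⟨M⁻¹.trace⁻¹, inv_pos.2 htr, fun a => ?_⟩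
  rw [inv_mul_le_iff₀ htr, trace, Finset.sum_mul]
  refine Finset.sum_le_sum fun i _ => ?_
  simpa [sq] using hM.sq_dotProduct_le (Pi.single i 1) a

theorem dotProduct_add_smul_one_mulVec (V : Matrix ι ι ℝ) (η : ℝ) (a : ι → ℝ) :
    a ⬝ᵥ (V + η • (1 : Matrix ι ι ℝ)) *ᵥ a = a ⬝ᵥ V *ᵥ a + η * (a ⬝ᵥ a) := by
  rw [add_mulVec, dotProduct_add, smul_mulVec, one_mulVec, dotProduct_smul, smul_eq_mul]

theorem PosSemidef.dotProduct_inv_add_smul_one_mulVec_le {V : Matrix ι ι ℝ} (hV : V.PosSemidef)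
    {η : ℝ} (hη : 0 < η) (z : ι → ℝ) :
    z ⬝ᵥ (V + η • (1 : Matrix ι ι ℝ))⁻¹ *ᵥ z ≤ (z ⬝ᵥ z) / η := by
  have hW := hV.posDef_add_smul_one hη
  set W := V + η • (1 : Matrix ι ι ℝ) with hWdef
  set b := W⁻¹ *ᵥ z with hb
  have hWb : W *ᵥ b = z := by
    rw [hb, mulVec_mulVec, mul_nonsing_inv _ (hW.isUnit.map detMonoidHom), one_mulVec]
  have hbb : η * (b ⬝ᵥ b) ≤ z ⬝ᵥ b := by
    have h := dotProduct_add_smul_one_mulVec V η b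
    have hVb := hV.dotProduct_mulVec_nonneg b
    rw [star_trivial] at hVb
    rw [← hWdef, hWb, dotProduct_comm] at h
    linarith
  have hsq : 0 ≤ (z - η • b) ⬝ᵥ (z - η • b) := by
    simpa using dotProduct_star_self_nonneg (z - η • b)
  simp only [sub_dotProduct, dotProduct_sub, smul_dotProduct, dotProduct_smul, smul_eq_mul,
    dotProduct_comm b z] at hsq
  rw [le_div_iff₀ hη]
  nlinarith

end Matrix

section Weight

variable {ι : Type*} [Fintype ι] [DecidableEq ι] {u : ℝ → ℝ} {W : Matrix ι ι ℝ}

theorem weight_mul_sq_dotProduct_nonneg (hu_pos : ∀ s : ℝ, 0 < s → 0 < u s) (hW : W.PosDef)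
    (z a : ι → ℝ) : 0 ≤ u (z ⬝ᵥ W⁻¹ *ᵥ z) * (z ⬝ᵥ a) ^ 2 := by
  by_cases hz : z = 0
  · simp [hz]
  · exact mul_nonneg (hu_pos _ (hW.inv.dotProduct_mulVec_pos hz)).le (sq_nonneg _)

theorem weight_mul_sq_dotProduct_le (hu_pos : ∀ s : ℝ, 0 < s → 0 < u s) {κ : ℝ} (hκ : 0 ≤ κ)
    (hψ : ∀ s : ℝ, 0 < s → s * u s ≤ κ) (hW : W.PosDef) (z a : ι → ℝ) :
    u (z ⬝ᵥ W⁻¹ *ᵥ z) * (z ⬝ᵥ a) ^ 2 ≤ κ * (a ⬝ᵥ W *ᵥ a) := by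
  have ha : 0 ≤ a ⬝ᵥ W *ᵥ a := hW.posSemidef.dotProduct_mulVec_nonneg a
  by_cases hz : z = 0
  · simpa [hz] using mul_nonneg hκ ha
  · have hs : 0 < z ⬝ᵥ W⁻¹ *ᵥ z := hW.inv.dotProduct_mulVec_pos hz
    calc u (z ⬝ᵥ W⁻¹ *ᵥ z) * (z ⬝ᵥ a) ^ 2
        ≤ u (z ⬝ᵥ W⁻¹ *ᵥ z) * ((z ⬝ᵥ W⁻¹ *ᵥ z) * (a ⬝ᵥ W *ᵥ a)) :=
          mul_le_mul_of_nonneg_left (hW.sq_dotProduct_le z a) (hu_pos _ hs).le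
      _ = (z ⬝ᵥ W⁻¹ *ᵥ z) * u (z ⬝ᵥ W⁻¹ *ᵥ z) * (a ⬝ᵥ W *ᵥ a) := by ring
      _ ≤ κ * (a ⬝ᵥ W *ᵥ a) := mul_le_mul_of_nonneg_right (hψ _ hs) ha

end Weight

/-- For nonzero spanning data `x₁,…,xₙ`, `η > 0`, and `u` non-increasing,
positive on `(0,∞)`, with `s·u(s) ≤ κ` on `(0,∞)` for some `0 ≤ κ < 1`, there exists
`c > 0` (independent of the contamination) such that for every contamination
`y₁,…,y_m` and every positive semidefinite solution `V` of the hybrid M-estimating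
equation on the combined sample, `c I ≤ V ≤ (ηκ/(1-κ)) I`. -/
theorem hybrid_M_no_breakdown
    (q n m : ℕ) (hq : 0 < q) (hn : 0 < n)
    (x : Fin n → Fin q → ℝ) (hx : ∀ i, x i ≠ 0)
    (hspan : Submodule.span ℝ (Set.range x) = ⊤)
    (u : ℝ → ℝ) (η : ℝ) (hη : 0 < η)
    (hu_anti : AntitoneOn u (Set.Ioi (0 : ℝ)))
    (hu_pos : ∀ s : ℝ, 0 < s → 0 < u s)
    (κ : ℝ) (hκ0 : 0 ≤ κ) (hκ1 : κ < 1)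
    (hψ : ∀ s : ℝ, 0 < s → s * u s ≤ κ) :
    ∃ c : ℝ, 0 < c ∧
      ∀ (y : Fin m → Fin q → ℝ) (V : Matrix (Fin q) (Fin q) ℝ),
        V.PosSemidef →
        V = (1 / ((n : ℝ) + m)) •
            ((∑ i : Fin n,
                u (x i ⬝ᵥ (V + η • (1 : Matrix (Fin q) (Fin q) ℝ))⁻¹ *ᵥ x i) •
                  vecMulVec (x i) (x i))
              + ∑ j : Fin m,
                  u (y j ⬝ᵥ (V + η • (1 : Matrix (Fin q) (Fin q) ℝ))⁻¹ *ᵥ y j) •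
                    vecMulVec (y j) (y j)) →
        (V - c • (1 : Matrix (Fin q) (Fin q) ℝ)).PosSemidef ∧
          ((η * κ / (1 - κ)) • (1 : Matrix (Fin q) (Fin q) ℝ) - V).PosSemidef := by
  have : Nonempty (Fin q) := ⟨⟨0, hq⟩⟩
  have hN : 0 < (n : ℝ) + m := by positivity
  have hxx : ∀ i, 0 < (x i ⬝ᵥ x i) / η := fun i =>
    div_pos (by simpa using dotProduct_star_self_pos_iff.2 (hx i)) hη
  obtain ⟨c, hc, hcM⟩ := (posDef_sum_smul_vecMulVec_self
    (fun i => hu_pos _ (hxx i)) hspan).exists_pos_mul_dotProduct_self_le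
  refine ⟨c / (n + m), div_pos hc hN, fun y V hV hVeq => ?_⟩
  have hW := hV.posDef_add_smul_one hη
  have hWa := dotProduct_add_smul_one_mulVec V η
  have hle := fun i => hV.dotProduct_inv_add_smul_one_mulVec_le hη (x i)
  set W := V + η • (1 : Matrix (Fin q) (Fin q) ℝ)
  have hform : ∀ a, ((n : ℝ) + m) * (a ⬝ᵥ V *ᵥ a) =
      ∑ i, u (x i ⬝ᵥ W⁻¹ *ᵥ x i) * (x i ⬝ᵥ a) ^ 2 +
        ∑ j, u (y j ⬝ᵥ W⁻¹ *ᵥ y j) * (y j ⬝ᵥ a) ^ 2 := fun a => by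
    rw [← dotProduct_sum_smul_vecMulVec_self_mulVec, ← dotProduct_sum_smul_vecMulVec_self_mulVec,
      ← dotProduct_add, ← add_mulVec]
    conv_lhs => rw [hVeq]
    rw [smul_mulVec, dotProduct_smul, smul_eq_mul, ← mul_assoc, mul_one_div_cancel hN.ne', one_mul]
  have hone : ∀ t : ℝ, (t • (1 : Matrix (Fin q) (Fin q) ℝ)).IsHermitian := fun t => by
    ext i j
    simp [one_apply, eq_comm]
  constructor
  · refine .of_dotProduct_mulVec_nonneg (hV.isHermitian.sub (hone _)) fun a => ?_
    rw [star_trivial, sub_mulVec, dotProduct_sub, smul_mulVec, one_mulVec, dotProduct_smul,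
      smul_eq_mul, sub_nonneg, div_mul_eq_mul_div, div_le_iff₀' hN, hform]
    refine (hcM a).trans ?_
    rw [dotProduct_sum_smul_vecMulVec_self_mulVec]
    refine le_add_of_le_of_nonneg (Finset.sum_le_sum fun i _ => ?_)
      (Finset.sum_nonneg fun j _ => weight_mul_sq_dotProduct_nonneg hu_pos hW _ _)
    exact mul_le_mul_of_nonneg_right
      (hu_anti (hW.inv.dotProduct_mulVec_pos (hx i)) (hxx i) (hle i)) (sq_nonneg _)
  · refine .of_dotProduct_mulVec_nonneg ((hone _).sub hV.isHermitian) fun a => ?_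
    rw [star_trivial, sub_mulVec, dotProduct_sub, smul_mulVec, one_mulVec, dotProduct_smul,
      smul_eq_mul, sub_nonneg, div_mul_eq_mul_div, le_div_iff₀ (sub_pos.2 hκ1)]
    have hsum : ((n : ℝ) + m) * (a ⬝ᵥ V *ᵥ a) ≤ (n + m) * (κ * (a ⬝ᵥ W *ᵥ a)) := by
      rw [hform, add_mul]
      refine add_le_add ?_ ?_
      · simpa using Finset.sum_le_card_nsmul Finset.univ _ _
          fun i _ => weight_mul_sq_dotProduct_le hu_pos hκ0 hψ hW (x i) a
      · simpa using Finset.sum_le_card_nsmul Finset.univ _ _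
          fun j _ => weight_mul_sq_dotProduct_le hu_pos hκ0 hψ hW (y j) a
    have h := le_of_mul_le_mul_left hsum hN
    rw [hWa] at h
    linarith
end

section
/- Let x₁, …, xₙ ∈ ℝ^q be nonzero vectors (the good data), let y₁, …, y_m ∈ ℝ^q be arbitrary nonzero vectors (the contamination), set N = n + m, and let 0 < γ < 1. Suppose V is a positive semidefinite q×q matrix satisfying the hybrid M-estimating equation V = (1/N) ∑_{z ∈ Z} u(zᵀ ((1−γ) V + γ I_q)⁻¹ z) z zᵀ over the combined sample Z = {x₁,…,xₙ, y₁,…,y_m}, where u : ℝ → ℝ is non-increasing on (0,∞) with u(s) ≥ 0 for s > 0. Then V ≥ (1/N) ∑_{i=1}^n u(xᵢᵀ xᵢ / γ) xᵢ xᵢᵀ in the Loewner order; in particular, this lower bound does not depend on the contamination y₁, …, y_m. -/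
open Matrix

/-- Adding a positive semidefinite matrix to `c • 1` decreases the inverse quadratic form. -/
theorem dotProduct_inv_add_smul_one_mulVec_le {ι : Type*} [Fintype ι] [DecidableEq ι]
    {A : Matrix ι ι ℝ} (hA : A.PosSemidef) {c : ℝ} (hc : 0 < c) (x : ι → ℝ) :
    x ⬝ᵥ (A + c • (1 : Matrix ι ι ℝ))⁻¹ *ᵥ x ≤ x ⬝ᵥ x / c := by
  have hM : (A + c • (1 : Matrix ι ι ℝ)).PosDef := PosDef.posSemidef_add hA (PosDef.one.smul hc)
  obtain ⟨w, hw⟩ : ∃ w, w = (A + c • (1 : Matrix ι ι ℝ))⁻¹ *ᵥ x := ⟨_, rfl⟩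
  have hx : x = A *ᵥ w + c • w := by
    have h : (A + c • (1 : Matrix ι ι ℝ)) *ᵥ w = x := by
      rw [hw, mulVec_mulVec, mul_nonsing_inv _ ((isUnit_iff_isUnit_det _).1 hM.isUnit),
        one_mulVec]
    rw [← h, add_mulVec, smul_mulVec, one_mulVec]
  rw [← hw, le_div_iff₀ hc]
  have h₁ : 0 ≤ w ⬝ᵥ A *ᵥ w := by simpa using hA.dotProduct_mulVec_nonneg w
  have h₂ : 0 ≤ A *ᵥ w ⬝ᵥ A *ᵥ w := by simpa using dotProduct_star_self_nonneg (A *ᵥ w)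
  have h₃ : x ⬝ᵥ x - x ⬝ᵥ w * c = A *ᵥ w ⬝ᵥ A *ᵥ w + c * (w ⬝ᵥ A *ᵥ w) := by
    rw [hx]
    simp only [add_dotProduct, dotProduct_add, smul_dotProduct, dotProduct_smul, smul_eq_mul]
    ring
  linarith [mul_nonneg hc.le h₁]

/-- A nonnegative multiple of `z zᵀ` is positive semidefinite. -/
theorem posSemidef_smul_vecMulVec_self {ι : Type*} [Fintype ι] {a : ℝ} (ha : 0 ≤ a)
    (z : ι → ℝ) : (a • vecMulVec z z).PosSemidef := by
  simpa using (posSemidef_vecMulVec_self_star z).smul ha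

/-- If a positive semidefinite `V` satisfies the Kullback–Leibler form of the
hybrid M-estimating equation over the contaminated sample `Z = {x₁,…,xₙ} ∪ {y₁,…,y_m}`
with `0 < γ < 1` and `u` non-increasing and nonnegative on `(0,∞)`, then
`V ≥ (1/(n+m)) ∑_{i=1}^n u(xᵢᵀxᵢ/γ) xᵢxᵢᵀ`, a bound free of the contamination `y`. -/
theorem hybrid_KL_contamination_lower_bound
    (q n m : ℕ) (hq : 0 < q) (hn : 0 < n)
    (x : Fin n → Fin q → ℝ) (hx : ∀ i, x i ≠ 0)
    (y : Fin m → Fin q → ℝ) (hy : ∀ j, y j ≠ 0)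
    (u : ℝ → ℝ) (γ : ℝ) (hγ0 : 0 < γ) (hγ1 : γ < 1)
    (hu_anti : AntitoneOn u (Set.Ioi (0 : ℝ)))
    (hu_nonneg : ∀ s : ℝ, 0 < s → 0 ≤ u s)
    (V : Matrix (Fin q) (Fin q) ℝ) (hV : V.PosSemidef)
    (heq : V = (1 / ((n : ℝ) + m)) •
        ((∑ i : Fin n,
            u (x i ⬝ᵥ ((1 - γ) • V + γ • (1 : Matrix (Fin q) (Fin q) ℝ))⁻¹ *ᵥ x i) •
              vecMulVec (x i) (x i))
          + ∑ j : Fin m,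
              u (y j ⬝ᵥ ((1 - γ) • V + γ • (1 : Matrix (Fin q) (Fin q) ℝ))⁻¹ *ᵥ y j) •
                vecMulVec (y j) (y j))) :
    (V - (1 / ((n : ℝ) + m)) •
        (∑ i : Fin n, u (x i ⬝ᵥ x i / γ) • vecMulVec (x i) (x i))).PosSemidef := by
  have hA : ((1 - γ) • V).PosSemidef := hV.smul (sub_nonneg.2 hγ1.le)
  have hM : ((1 - γ) • V + γ • (1 : Matrix (Fin q) (Fin q) ℝ)).PosDef :=
    PosDef.posSemidef_add hA (PosDef.one.smul hγ0)
  have hle := dotProduct_inv_add_smul_one_mulVec_le hA hγ0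
  have hpos : ∀ z : Fin q → ℝ, z ≠ 0 →
      0 < z ⬝ᵥ ((1 - γ) • V + γ • (1 : Matrix (Fin q) (Fin q) ℝ))⁻¹ *ᵥ z := fun z hz => by
    simpa using hM.inv.dotProduct_mulVec_pos hz
  generalize ((1 - γ) • V + γ • (1 : Matrix (Fin q) (Fin q) ℝ))⁻¹ = B at heq hle hpos
  rw [heq, ← smul_sub, add_sub_right_comm, ← Finset.sum_sub_distrib]
  refine PosSemidef.smul (PosSemidef.add (posSemidef_sum _ fun i _ => ?_)
    (posSemidef_sum _ fun j _ => ?_)) (by positivity)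
  · rw [← sub_smul]
    have hi := hpos _ (hx i)
    exact posSemidef_smul_vecMulVec_self
      (sub_nonneg.2 (hu_anti hi (hi.trans_le (hle _)) (hle _))) _
  · exact posSemidef_smul_vecMulVec_self (hu_nonneg _ (hpos _ (hy j))) _
end

section
/- Let 0 < γ ≤ 1 and let V be a positive semidefinite q×q real matrix satisfying the hybrid M-estimating equation V = (1/n) ∑_{i=1}^n u(xᵢᵀ ((1−γ) V + γ I_q)⁻¹ xᵢ) xᵢ xᵢᵀ, where u(s) ≥ 0 for all s ≥ 0 and s·u(s) ≤ κ for all s > 0 with κ ≥ 0 satisfying (1−γ)κ < 1. Then 0 ≤ V ≤ (γ κ/(1−(1−γ)κ)) I_q in the Loewner order. -/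
open Matrix

theorem Matrix.PosDef.sq_dotProduct_le_s13 {m : Type*} [Fintype m] [DecidableEq m]
    {M : Matrix m m ℝ} (hM : M.PosDef) (x y : m → ℝ) :
    (x ⬝ᵥ y) ^ 2 ≤ (x ⬝ᵥ M⁻¹ *ᵥ x) * (y ⬝ᵥ M *ᵥ y) := by
  have hMT : Mᵀ = M := by simpa using hM.isHermitian.eq
  set z := M⁻¹ *ᵥ x with hz
  have hMz : M *ᵥ z = x := by
    rw [hz, mulVec_mulVec, mul_nonsing_inv _ hM.det_pos.ne'.isUnit, one_mulVec]
  have hzy : z ⬝ᵥ M *ᵥ y = x ⬝ᵥ y := by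
    rw [dotProduct_mulVec, ← mulVec_transpose, hMT, hMz]
  have key (t : ℝ) : 0 ≤ (x ⬝ᵥ z) * (t * t) + (-2 * (x ⬝ᵥ y)) * t + y ⬝ᵥ M *ᵥ y := by
    have h := hM.posSemidef.dotProduct_mulVec_nonneg (y - t • z)
    simp only [star_trivial, mulVec_sub, mulVec_smul, hMz, sub_dotProduct, dotProduct_sub,
      smul_dotProduct, dotProduct_smul, hzy, smul_eq_mul, dotProduct_comm y x,
      dotProduct_comm z x] at h
    linarith
  have := discrim_le_zero key
  rw [discrim] at this
  linarith

theorem Matrix.PosDef.weight_mul_sq_dotProduct_le {m : Type*} [Fintype m] [DecidableEq m]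
    {M : Matrix m m ℝ} (hM : M.PosDef) {u : ℝ → ℝ} {κ : ℝ} (hκ : 0 ≤ κ)
    (hu : ∀ s : ℝ, 0 ≤ s → 0 ≤ u s) (hψ : ∀ s : ℝ, 0 < s → s * u s ≤ κ) (x y : m → ℝ) :
    u (x ⬝ᵥ M⁻¹ *ᵥ x) * (x ⬝ᵥ y) ^ 2 ≤ κ * (y ⬝ᵥ M *ᵥ y) := by
  have hy : 0 ≤ y ⬝ᵥ M *ᵥ y := hM.posSemidef.dotProduct_mulVec_nonneg y
  rcases eq_or_ne x 0 with rfl | hx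
  · simpa using mul_nonneg hκ hy
  · have hs : 0 < x ⬝ᵥ M⁻¹ *ᵥ x := hM.inv.dotProduct_mulVec_pos hx
    calc u (x ⬝ᵥ M⁻¹ *ᵥ x) * (x ⬝ᵥ y) ^ 2
        ≤ u (x ⬝ᵥ M⁻¹ *ᵥ x) * ((x ⬝ᵥ M⁻¹ *ᵥ x) * (y ⬝ᵥ M *ᵥ y)) :=
          mul_le_mul_of_nonneg_left (hM.sq_dotProduct_le_s13 x y) (hu _ hs.le)
      _ = ((x ⬝ᵥ M⁻¹ *ᵥ x) * u (x ⬝ᵥ M⁻¹ *ᵥ x)) * (y ⬝ᵥ M *ᵥ y) := by ring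
      _ ≤ κ * (y ⬝ᵥ M *ᵥ y) := mul_le_mul_of_nonneg_right (hψ _ hs) hy


/-- If a positive semidefinite `V` satisfies the Kullback–Leibler form of the
hybrid M-estimating equation `V = (1/n) ∑ u(xᵢᵀ ((1-γ)V + γ I)⁻¹ xᵢ) xᵢxᵢᵀ` with
`0 < γ ≤ 1`, `u ≥ 0` on `[0,∞)`, and `s·u(s) ≤ κ` on `(0,∞)` with `κ ≥ 0`,
`(1-γ)κ < 1`, then `0 ≤ V ≤ (γκ/(1-(1-γ)κ)) I`. -/
theorem hybrid_KL_upper_bound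
    (q n : ℕ) (hq : 0 < q) (hn : 0 < n)
    (x : Fin n → Fin q → ℝ) (u : ℝ → ℝ)
    (γ : ℝ) (hγ0 : 0 < γ) (hγ1 : γ ≤ 1)
    (κ : ℝ) (hκ0 : 0 ≤ κ) (hκ1 : (1 - γ) * κ < 1)
    (hu : ∀ s : ℝ, 0 ≤ s → 0 ≤ u s)
    (hψ : ∀ s : ℝ, 0 < s → s * u s ≤ κ)
    (V : Matrix (Fin q) (Fin q) ℝ) (hV : V.PosSemidef)
    (heq : V = (1 / (n : ℝ)) •
        (∑ i : Fin n,
          u (x i ⬝ᵥ ((1 - γ) • V + γ • (1 : Matrix (Fin q) (Fin q) ℝ))⁻¹ *ᵥ x i) •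
            vecMulVec (x i) (x i))) :
    V.PosSemidef ∧
      ((γ * κ / (1 - (1 - γ) * κ)) • (1 : Matrix (Fin q) (Fin q) ℝ) - V).PosSemidef := by
  refine ⟨hV, .of_dotProduct_mulVec_nonneg
    ((isHermitian_one.smul (IsSelfAdjoint.all _)).sub hV.isHermitian) fun y => ?_⟩
  set M := (1 - γ) • V + γ • (1 : Matrix (Fin q) (Fin q) ℝ) with hMdef
  have hM : M.PosDef :=
    PosDef.posSemidef_add (hV.smul (sub_nonneg.2 hγ1)) (PosDef.one.smul hγ0)
  have hMy : y ⬝ᵥ M *ᵥ y = (1 - γ) * (y ⬝ᵥ V *ᵥ y) + γ * (y ⬝ᵥ y) := by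
    simp [hMdef, add_mulVec, smul_mulVec]
  have hVy : y ⬝ᵥ V *ᵥ y =
      (1 / (n : ℝ)) * ∑ i, u (x i ⬝ᵥ M⁻¹ *ᵥ x i) * (x i ⬝ᵥ y) ^ 2 := by
    conv_lhs => rw [heq]
    simp only [smul_mulVec, sum_mulVec, vecMulVec_mulVec, dotProduct_comm y, smul_dotProduct,
      sum_dotProduct, smul_eq_mul, op_smul_eq_smul, sq]
  have hle : y ⬝ᵥ V *ᵥ y ≤ κ * (y ⬝ᵥ M *ᵥ y) := by
    have hsum := Finset.sum_le_card_nsmul Finset.univ _ _ fun i _ =>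
      hM.weight_mul_sq_dotProduct_le hκ0 hu hψ (x i) y
    rw [Finset.card_univ, Fintype.card_fin, nsmul_eq_mul] at hsum
    rw [hVy, one_div, inv_mul_le_iff₀ (by exact_mod_cast hn)]
    exact hsum
  have hden : 0 < 1 - (1 - γ) * κ := sub_pos.2 hκ1
  simp only [star_trivial, sub_mulVec, smul_mulVec, one_mulVec, dotProduct_sub, dotProduct_smul,
    smul_eq_mul, sub_nonneg]
  rw [div_mul_eq_mul_div, le_div_iff₀ hden]
  rw [hMy] at hle
  linarith
end
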